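/- Let p, q ∈ [1,∞] and let q* = q/(q−1) be the Hölder conjugate of q. For every A ∈ ℝ^{m×n}, the dual norm of the operator (p,q)-norm equals the nuclear (q*,p)-norm: sup{ tr(BᵀA) : B ∈ ℝ^{m×n}, ‖B‖_{p,q} ≤ 1 } = ‖A‖_{*,q*,p}. -/

import Mathlib

open scoped BigOperators ENNReal
open Matrix

noncomputable section

/-- The `l^p` norm of a vector in `ℝ^k`, for `p ∈ [1, ∞]` (an extended nonnegative real). -/
def pNorm (p : ℝ≥0∞) {k : ℕ} (x : Fin k → ℝ) : ℝ :=
  ‖(WithLp.equiv p (∀ _ : Fin k, ℝ)).symm x‖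

/-- The operator `(p,q)`-norm of a matrix: `‖A‖_{p,q} = sup { ‖Ax‖_q : ‖x‖_p = 1 }`. -/
def opNorm (p q : ℝ≥0∞) {m n : ℕ} (A : Matrix (Fin m) (Fin n) ℝ) : ℝ :=
  sSup { r : ℝ | ∃ x : Fin n → ℝ, pNorm p x = 1 ∧ r = pNorm q (A.mulVec x) }

/-- The nuclear `(p,q)`-norm of a matrix:
`‖A‖_{*,p,q} = inf { Σ |λ_i| : A = Σ λ_i u_i v_iᵀ, ‖u_i‖_p = ‖v_i‖_q = 1 }`. -/
def nucNorm (p q : ℝ≥0∞) {m n : ℕ} (A : Matrix (Fin m) (Fin n) ℝ) : ℝ :=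
  sInf { s : ℝ | ∃ (r : ℕ) (lam : Fin r → ℝ)
      (u : Fin r → (Fin m → ℝ)) (v : Fin r → (Fin n → ℝ)),
    (∀ i, pNorm p (u i) = 1 ∧ pNorm q (v i) = 1) ∧
    A = (∑ i, lam i • Matrix.vecMulVec (u i) (v i)) ∧ s = ∑ i, |lam i| }

/-- `NuclearRep p q A s` says that `A` has a decomposition into `p`-`q`-normalized rank-one matrices
of total weight `s`. -/
def NuclearRep (p q : ℝ≥0∞) {m n : ℕ} (A : Matrix (Fin m) (Fin n) ℝ) (s : ℝ) : Prop :=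
  ∃ (r : ℕ) (lam : Fin r → ℝ) (u : Fin r → (Fin m → ℝ)) (v : Fin r → (Fin n → ℝ)),
    (∀ i, pNorm p (u i) = 1 ∧ pNorm q (v i) = 1) ∧
    A = (∑ i, lam i • Matrix.vecMulVec (u i) (v i)) ∧ s = ∑ i, |lam i|

lemma nucNorm_eq (p q : ℝ≥0∞) {m n : ℕ} (A : Matrix (Fin m) (Fin n) ℝ) :
    nucNorm p q A = sInf {s | NuclearRep p q A s} := rfl

section pNorm

variable {k : ℕ}

lemma pNorm_one_eq (x : Fin k → ℝ) : pNorm 1 x = ∑ i, |x i| := by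
  simp [pNorm, PiLp.norm_eq_of_L1]

lemma pNorm_top_eq (x : Fin k → ℝ) : pNorm ∞ x = ⨆ i, |x i| := by
  simp [pNorm, PiLp.norm_eq_ciSup]

lemma pNorm_eq_sum {p : ℝ≥0∞} (hp : 0 < p.toReal) (x : Fin k → ℝ) :
    pNorm p x = (∑ i, |x i| ^ p.toReal) ^ (1 / p.toReal) := by
  simp [pNorm, PiLp.norm_eq_sum hp]

lemma abs_le_pNorm_top (x : Fin k → ℝ) (i : Fin k) : |x i| ≤ pNorm ∞ x := by
  rw [pNorm_top_eq]
  exact le_ciSup (f := fun i => |x i|) (Set.finite_range _).bddAbove i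

lemma pNorm_nonneg {p : ℝ≥0∞} (hp : 1 ≤ p) (x : Fin k → ℝ) : 0 ≤ pNorm p x := by
  have : Fact (1 ≤ p) := ⟨hp⟩
  exact norm_nonneg _

lemma pNorm_smul {p : ℝ≥0∞} (hp : 1 ≤ p) (c : ℝ) (x : Fin k → ℝ) :
    pNorm p (c • x) = |c| * pNorm p x := by
  have : Fact (1 ≤ p) := ⟨hp⟩
  simp [pNorm, norm_smul]

lemma eq_zero_of_pNorm_eq_zero {p : ℝ≥0∞} (hp : 1 ≤ p) {x : Fin k → ℝ} (h : pNorm p x = 0) :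
    x = 0 := by
  have : Fact (1 ≤ p) := ⟨hp⟩
  simpa [pNorm] using h

lemma pNorm_single {p : ℝ≥0∞} (hp : 1 ≤ p) (i : Fin k) (b : ℝ) :
    pNorm p (Pi.single i b) = |b| := by
  have : Fact (1 ≤ p) := ⟨hp⟩
  exact PiLp.norm_single p (fun _ : Fin k => ℝ) i b

lemma dotProduct_le_of_one_top (x y : Fin k → ℝ) : x ⬝ᵥ y ≤ pNorm 1 x * pNorm ∞ y := by
  rw [pNorm_one_eq, Finset.sum_mul]
  refine Finset.sum_le_sum fun i _ => (le_abs_self _).trans ?_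
  rw [abs_mul]
  exact mul_le_mul_of_nonneg_left (abs_le_pNorm_top y i) (abs_nonneg _)

/-- Conjugate exponents are either `(1, ∞)`, `(∞, 1)`, or finite real conjugate exponents. -/
lemma conjugate_cases {q qs : ℝ≥0∞} (h : q⁻¹ + qs⁻¹ = 1) :
    (q = 1 ∧ qs = ∞) ∨ (q = ∞ ∧ qs = 1) ∨ q.toReal.HolderConjugate qs.toReal := by
  have hc : q.HolderConjugate qs := ENNReal.holderConjugate_iff.2 h
  rcases eq_or_ne q ∞ with rfl | hq
  · exact .inr (.inl ⟨rfl, by simpa using h⟩)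
  rcases eq_or_ne qs ∞ with rfl | hqs
  · exact .inl ⟨by simpa using h, rfl⟩
  exact .inr (.inr (ENNReal.HolderConjugate.toReal_of_ne_top hq hqs))

lemma one_le_conjugate {q qs : ℝ≥0∞} (h : q⁻¹ + qs⁻¹ = 1) : 1 ≤ qs := by
  rw [← ENNReal.inv_le_one, ← h]
  exact le_add_self

lemma dotProduct_le_pNorm_mul_pNorm {q qs : ℝ≥0∞} (h : q⁻¹ + qs⁻¹ = 1) (u y : Fin k → ℝ) :
    u ⬝ᵥ y ≤ pNorm qs u * pNorm q y := by
  obtain ⟨rfl, rfl⟩ | ⟨rfl, rfl⟩ | hc := conjugate_cases h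
  · rw [dotProduct_comm, mul_comm]
    exact dotProduct_le_of_one_top y u
  · exact dotProduct_le_of_one_top u y
  · rw [pNorm_eq_sum hc.pos, pNorm_eq_sum hc.symm.pos]
    exact Real.inner_le_Lp_mul_Lq _ u y hc.symm

lemma abs_sign_le_one (a : ℝ) : |(SignType.sign a : ℝ)| ≤ 1 := by
  rcases SignType.sign a with _ | _ | _ <;> simp

/-- Hölder's inequality is attained. -/
lemma exists_dotProduct_eq_pNorm {q qs : ℝ≥0∞} (h : q⁻¹ + qs⁻¹ = 1) (y : Fin k → ℝ) :
    ∃ u : Fin k → ℝ, pNorm qs u ≤ 1 ∧ u ⬝ᵥ y = pNorm q y := by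
  obtain ⟨rfl, rfl⟩ | ⟨rfl, rfl⟩ | hc := conjugate_cases h
  · refine ⟨fun i => SignType.sign (y i), ?_, ?_⟩
    · rw [pNorm_top_eq]
      exact Real.iSup_le (fun i => abs_sign_le_one _) zero_le_one
    · simp [pNorm_one_eq, dotProduct]
  · rcases isEmpty_or_nonempty (Fin k) with hk | hk
    · exact ⟨0, by simp [pNorm_one_eq], by simp [pNorm_top_eq]⟩
    obtain ⟨i, hi⟩ := exists_eq_ciSup_of_finite (f := fun i => |y i|)
    refine ⟨Pi.single i (SignType.sign (y i)), ?_, ?_⟩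
    · rw [pNorm_single le_rfl]
      exact abs_sign_le_one _
    · rw [single_dotProduct, sign_mul_self, pNorm_top_eq, hi]
  · obtain ⟨g, hg, hgy⟩ := (NNReal.isGreatest_Lp Finset.univ (fun i => ‖y i‖₊) hc).1
    have hg' : ∑ i, (g i : ℝ) ^ qs.toReal ≤ 1 := by exact_mod_cast hg
    refine ⟨fun i => SignType.sign (y i) * g i, ?_, ?_⟩
    · rw [pNorm_eq_sum hc.symm.pos]
      refine Real.rpow_le_one (by positivity) (le_trans ?_ hg') (by positivity)
      refine Finset.sum_le_sum fun i _ => Real.rpow_le_rpow (abs_nonneg _) ?_ hc.symm.pos.le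
      rw [abs_mul, NNReal.abs_eq]
      exact mul_le_of_le_one_left (g i).2 (abs_sign_le_one _)
    · have := congrArg NNReal.toReal hgy
      push_cast at this
      rw [pNorm_eq_sum hc.pos]
      simp only [Real.norm_eq_abs] at this
      rw [← this]
      refine Finset.sum_congr rfl fun i _ => ?_
      rw [← sign_mul_self]
      ring

lemma pNorm_le_one_of_dotProduct_le_one {q qs : ℝ≥0∞} (h : q⁻¹ + qs⁻¹ = 1)
    {y : Fin k → ℝ} (hy : ∀ u, pNorm qs u = 1 → u ⬝ᵥ y ≤ 1) : pNorm q y ≤ 1 := by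
  have hqs := one_le_conjugate h
  obtain ⟨u, hu, huy⟩ := exists_dotProduct_eq_pNorm h y
  rw [← huy]
  rcases (pNorm_nonneg hqs u).eq_or_lt with h0 | h0
  · simp [eq_zero_of_pNorm_eq_zero hqs h0.symm]
  have h1 := hy ((pNorm qs u)⁻¹ • u) (by
    rw [pNorm_smul hqs, abs_of_pos (inv_pos.2 h0), inv_mul_cancel₀ h0.ne'])
  rw [smul_dotProduct, smul_eq_mul, inv_mul_le_iff₀ h0, mul_one] at h1
  exact h1.trans hu

end pNorm

section matrices

variable {m n : ℕ}

lemma pNorm_mulVec_le_opNorm {p q : ℝ≥0∞} (hp : 1 ≤ p) (hq : 1 ≤ q)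
    (B : Matrix (Fin m) (Fin n) ℝ) {x : Fin n → ℝ} (hx : pNorm p x = 1) :
    pNorm q (B *ᵥ x) ≤ opNorm p q B := by
  have : Fact (1 ≤ p) := ⟨hp⟩
  have : Fact (1 ≤ q) := ⟨hq⟩
  refine le_csSup ?_ ⟨x, hx, rfl⟩
  let L : PiLp p (fun _ : Fin n => ℝ) →L[ℝ] PiLp q (fun _ : Fin m => ℝ) :=
    LinearMap.toContinuousLinearMap ((WithLp.linearEquiv q ℝ (Fin m → ℝ)).symm.toLinearMap ∘ₗ
      B.mulVecLin ∘ₗ (WithLp.linearEquiv p ℝ (Fin n → ℝ)).toLinearMap)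
  refine ⟨‖L‖, ?_⟩
  rintro _ ⟨z, hz, rfl⟩
  have h := L.le_opNorm (WithLp.toLp p z)
  rwa [show ‖WithLp.toLp p z‖ = 1 from hz, mul_one] at h

lemma trace_transpose_mul_vecMulVec (B : Matrix (Fin m) (Fin n) ℝ) (u : Fin m → ℝ)
    (v : Fin n → ℝ) : (Bᵀ * vecMulVec u v).trace = u ⬝ᵥ B *ᵥ v := by
  rw [mul_vecMulVec, trace_vecMulVec, mulVec_transpose, dotProduct_mulVec]

namespace NuclearRep

variable {p q : ℝ≥0∞} {A A' : Matrix (Fin m) (Fin n) ℝ} {s s' : ℝ}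

lemma nonneg (h : NuclearRep p q A s) : 0 ≤ s := by
  obtain ⟨r, lam, u, v, -, -, rfl⟩ := h
  positivity

lemma add (h : NuclearRep p q A s) (h' : NuclearRep p q A' s') :
    NuclearRep p q (A + A') (s + s') := by
  obtain ⟨r, lam, u, v, huv, rfl, rfl⟩ := h
  obtain ⟨r', lam', u', v', huv', rfl, rfl⟩ := h'
  refine ⟨r + r', Fin.append lam lam', Fin.append u u', Fin.append v v', fun i => ?_, ?_, ?_⟩
  · induction i using Fin.addCases <;> simp [huv, huv']
  · simp [Fin.sum_univ_add]
  · simp [Fin.sum_univ_add]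

lemma smul (c : ℝ) (h : NuclearRep p q A s) : NuclearRep p q (c • A) (|c| * s) := by
  obtain ⟨r, lam, u, v, huv, rfl, rfl⟩ := h
  refine ⟨r, fun i => c * lam i, u, v, huv, ?_, ?_⟩
  · simp [Finset.smul_sum, mul_smul]
  · simp [Finset.mul_sum, abs_mul]

protected lemma zero : NuclearRep p q (0 : Matrix (Fin m) (Fin n) ℝ) 0 :=
  ⟨0, 0, 0, 0, fun i => i.elim0, by simp, by simp⟩

lemma vecMulVec {u : Fin m → ℝ} {v : Fin n → ℝ} (hu : pNorm p u = 1) (hv : pNorm q v = 1) :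
    NuclearRep p q (vecMulVec u v) 1 :=
  ⟨1, fun _ => 1, fun _ => u, fun _ => v, fun _ => ⟨hu, hv⟩, by simp, by simp⟩

lemma exists_sum {ι : Type*} (t : Finset ι) (M : ι → Matrix (Fin m) (Fin n) ℝ)
    (h : ∀ i, ∃ s, NuclearRep p q (M i) s) : ∃ s, NuclearRep p q (∑ i ∈ t, M i) s := by
  classical
  induction t using Finset.induction_on with
  | empty => exact ⟨0, by simpa using NuclearRep.zero⟩
  | insert i t hi ih =>
    obtain ⟨a, ha⟩ := ih
    obtain ⟨b, hb⟩ := h i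
    exact ⟨b + a, by simpa [Finset.sum_insert hi] using hb.add ha⟩

lemma exists_rep (hp : 1 ≤ p) (hq : 1 ≤ q) (A : Matrix (Fin m) (Fin n) ℝ) :
    ∃ s, NuclearRep p q A s := by
  rw [matrix_eq_sum_single A]
  refine exists_sum _ _ fun i => exists_sum _ _ fun j => ⟨|A i j| * 1, ?_⟩
  rw [show Matrix.single i j (A i j)
      = A i j • Matrix.vecMulVec (Pi.single i 1) (Pi.single j 1) by
    rw [← single_eq_single_vecMulVec_single]; simp]
  exact smul _ (vecMulVec (by simp [pNorm_single hp]) (by simp [pNorm_single hq]))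

lemma nucNorm_le (h : NuclearRep p q A s) : nucNorm p q A ≤ s :=
  csInf_le ⟨0, fun _ h => NuclearRep.nonneg h⟩ h

end NuclearRep

section nucNorm

variable {p q : ℝ≥0∞}

lemma le_nucNorm (hp : 1 ≤ p) (hq : 1 ≤ q) {A : Matrix (Fin m) (Fin n) ℝ} {c : ℝ}
    (h : ∀ s, NuclearRep p q A s → c ≤ s) : c ≤ nucNorm p q A :=
  le_csInf (NuclearRep.exists_rep hp hq A) h

lemma nucNorm_nonneg (A : Matrix (Fin m) (Fin n) ℝ) : 0 ≤ nucNorm p q A :=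
  Real.sInf_nonneg fun _ h => NuclearRep.nonneg h

lemma nucNorm_zero : nucNorm p q (0 : Matrix (Fin m) (Fin n) ℝ) = 0 :=
  le_antisymm NuclearRep.zero.nucNorm_le (nucNorm_nonneg _)

lemma nucNorm_add_le (hp : 1 ≤ p) (hq : 1 ≤ q) (A A' : Matrix (Fin m) (Fin n) ℝ) :
    nucNorm p q (A + A') ≤ nucNorm p q A + nucNorm p q A' := by
  rw [← sub_le_iff_le_add]
  refine le_nucNorm hp hq fun s hs => ?_
  rw [sub_le_comm]
  refine le_nucNorm hp hq fun s' hs' => ?_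
  linarith [(hs.add hs').nucNorm_le]

lemma nucNorm_smul (hp : 1 ≤ p) (hq : 1 ≤ q) {c : ℝ} (hc : 0 < c)
    (A : Matrix (Fin m) (Fin n) ℝ) : nucNorm p q (c • A) = c * nucNorm p q A := by
  refine le_antisymm ?_ (le_nucNorm hp hq fun s hs => ?_)
  · rw [← inv_mul_le_iff₀ hc, mul_comm]
    refine le_nucNorm hp hq fun s hs => ?_
    rw [← div_eq_mul_inv, div_le_iff₀' hc]
    simpa [abs_of_pos hc] using (hs.smul c).nucNorm_le
  · rw [← le_inv_mul_iff₀ hc]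
    simpa [smul_smul, inv_mul_cancel₀ hc.ne', abs_of_pos hc] using (hs.smul c⁻¹).nucNorm_le

/-- Every linear functional on matrices is a trace pairing. -/
lemma exists_trace_eq (f : Matrix (Fin m) (Fin n) ℝ →ₗ[ℝ] ℝ) :
    ∃ B : Matrix (Fin m) (Fin n) ℝ, ∀ M, f M = (Bᵀ * M).trace := by
  refine ⟨Matrix.of fun i j => f (Matrix.single i j 1), fun M => ?_⟩
  have : ∀ i j, Matrix.single i j (M i j) = M i j • Matrix.single i j (1 : ℝ) := by simp
  conv_lhs => rw [matrix_eq_sum_single M]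
  simp only [this, map_sum, map_smul, smul_eq_mul, trace, diag_apply, mul_apply, transpose_apply,
    of_apply]
  rw [Finset.sum_comm]
  simp only [mul_comm]

/-- Hahn–Banach: the nuclear norm has a supporting functional at every matrix. -/
lemma exists_supporting_functional (hp : 1 ≤ p) (hq : 1 ≤ q) (A : Matrix (Fin m) (Fin n) ℝ) :
    ∃ f : Matrix (Fin m) (Fin n) ℝ →ₗ[ℝ] ℝ, f A = nucNorm p q A ∧ ∀ M, f M ≤ nucNorm p q M := by
  rcases eq_or_ne A 0 with rfl | hA
  · exact ⟨0, by simp [nucNorm_zero], fun M => by simpa using nucNorm_nonneg M⟩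
  obtain ⟨f, hf, hfN⟩ := exists_extension_of_le_sublinear
    (LinearPMap.mkSpanSingleton A (nucNorm p q A) hA) (nucNorm p q)
    (fun c hc M => nucNorm_smul hp hq hc M) (nucNorm_add_le hp hq) (by
      rintro ⟨x, hx⟩
      obtain ⟨c, rfl⟩ := Submodule.mem_span_singleton.1 hx
      rw [LinearPMap.mkSpanSingleton'_apply]
      rcases le_or_gt c 0 with hc | hc
      · exact (mul_nonpos_of_nonpos_of_nonneg hc (nucNorm_nonneg A)).trans (nucNorm_nonneg _)
      · exact (nucNorm_smul hp hq hc A).ge)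
  refine ⟨f, ?_, hfN⟩
  have hmem : A ∈ (LinearPMap.mkSpanSingleton (σ := RingHom.id ℝ) A (nucNorm p q A) hA).domain :=
    Submodule.mem_span_singleton_self A
  exact (hf ⟨A, hmem⟩).trans (LinearPMap.mkSpanSingleton'_apply_self _ _ _ _)

end nucNorm

lemma trace_le_of_nuclearRep {p q qs : ℝ≥0∞} (hp : 1 ≤ p) (hq : 1 ≤ q) (hqs : q⁻¹ + qs⁻¹ = 1)
    {A B : Matrix (Fin m) (Fin n) ℝ} (hB : opNorm p q B ≤ 1) {s : ℝ} (h : NuclearRep qs p A s) :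
    (Bᵀ * A).trace ≤ s := by
  obtain ⟨r, lam, u, v, huv, rfl, rfl⟩ := h
  simp only [Matrix.mul_sum, trace_sum, Matrix.mul_smul, trace_smul, trace_transpose_mul_vecMulVec,
    smul_eq_mul]
  refine Finset.sum_le_sum fun i _ => ?_
  have key : ∀ w, pNorm qs w = 1 → w ⬝ᵥ B *ᵥ v i ≤ 1 := fun w hw => by
    have := dotProduct_le_pNorm_mul_pNorm hqs w (B *ᵥ v i)
    rw [hw, one_mul] at this
    exact this.trans ((pNorm_mulVec_le_opNorm hp hq B (huv i).2).trans hB)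
  have hqs1 := one_le_conjugate hqs
  have h1 := key _ (huv i).1
  have h2 := key ((-1 : ℝ) • u i) (by rw [pNorm_smul hqs1, (huv i).1]; simp)
  rw [smul_dotProduct, smul_eq_mul, neg_one_mul] at h2
  refine (le_abs_self _).trans ?_
  rw [abs_mul]
  exact mul_le_of_le_one_right (abs_nonneg _) (abs_le.2 ⟨by linarith, h1⟩)

end matrices

/-- Theorem 7.1: the dual norm of the operator `(p,q)`-norm is the nuclear `(q*,p)`-norm,
where `q*` is the Hölder conjugate of `q`. -/
theorem stmt15 {m n : ℕ} (p q qs : ℝ≥0∞) (hp : 1 ≤ p) (hq : 1 ≤ q)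
    (hqs : q⁻¹ + qs⁻¹ = 1) (A : Matrix (Fin m) (Fin n) ℝ) :
    sSup { r : ℝ | ∃ B : Matrix (Fin m) (Fin n) ℝ,
        opNorm p q B ≤ 1 ∧ r = (Bᵀ * A).trace }
      = nucNorm qs p A := by
  have hqs1 := one_le_conjugate hqs
  refine IsGreatest.csSup_eq ⟨?_, ?_⟩
  · obtain ⟨f, hfA, hf⟩ := exists_supporting_functional hqs1 hp A
    obtain ⟨B, hB⟩ := exists_trace_eq f
    refine ⟨B, Real.sSup_le ?_ zero_le_one, by rw [← hB, hfA]⟩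
    rintro _ ⟨x, hx, rfl⟩
    refine pNorm_le_one_of_dotProduct_le_one hqs fun u hu => ?_
    rw [← trace_transpose_mul_vecMulVec, ← hB]
    exact (hf _).trans (NuclearRep.vecMulVec hu hx).nucNorm_le
  · rintro _ ⟨B, hB, rfl⟩
    exact le_nucNorm hqs1 hp fun s hs => trace_le_of_nuclearRep hp hq hqs hB hs
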